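/- Level sets of strictly subharmonic functions are Lebesgue-null (Lemma 6.5, after Frank–Lieb). Let U ⊆ ℝ^d be an open set and let ψ ∈ L¹_loc(U). Suppose there exists a nonnegative, locally finite Borel measure μ_ψ on U such that (i) ∫_U ψ(x) Δϕ(x) dx = ∫_U ϕ dμ_ψ for every smooth compactly supported test function ϕ ∈ C_c^∞(U) (that is, the distributional Laplacian of ψ equals μ_ψ), and (ii) μ_ψ(E) > 0 for every measurable E ⊆ U with positive Lebesgue measure. Then for every r ∈ ℝ, the set {x ∈ U : ψ(x) = r} has Lebesgue measure zero. -/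

import Mathlib

open MeasureTheory Metric Set

noncomputable def laplacian {d : ℕ} (f : EuclideanSpace ℝ (Fin d) → ℝ)
    (x : EuclideanSpace ℝ (Fin d)) : ℝ :=
  ∑ i : Fin d, iteratedFDeriv ℝ 2 f x
    ![EuclideanSpace.single i (1:ℝ), EuclideanSpace.single i (1:ℝ)]

open Filter Topology Polynomial

/-- A smooth nonincreasing function, positive exactly on `(-∞, 1)`. -/
noncomputable def profile (t : ℝ) : ℝ := expNegInvGlue (1 - t)

lemma contDiff_profile {n : ℕ∞} : ContDiff ℝ n profile :=
  expNegInvGlue.contDiff.comp (contDiff_const.sub contDiff_id)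

lemma profile_nonneg (t : ℝ) : 0 ≤ profile t := expNegInvGlue.nonneg _

lemma profile_pos {t : ℝ} (ht : t < 1) : 0 < profile t :=
  expNegInvGlue.pos_of_pos (sub_pos.2 ht)

lemma profile_eq_zero {t : ℝ} (ht : 1 ≤ t) : profile t = 0 :=
  expNegInvGlue.zero_of_nonpos (sub_nonpos.2 ht)

lemma profile_antitone : Antitone profile := fun _ _ h =>
  expNegInvGlue.monotone (sub_le_sub_left h 1)

lemma hasDerivAt_polynomial_mul_profile (p : ℝ[X]) (t : ℝ) :
    HasDerivAt (fun t => p.eval (1 - t)⁻¹ * profile t)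
      ((-(X ^ 2 * (p - derivative p))).eval (1 - t)⁻¹ * profile t) t := by
  have h := (expNegInvGlue.hasDerivAt_polynomial_eval_inv_mul p (1 - t)).scomp t
    ((hasDerivAt_id t).const_sub 1)
  refine h.congr_deriv ?_
  simp [profile]

lemma deriv_polynomial_mul_profile (p : ℝ[X]) :
    deriv (fun t => p.eval (1 - t)⁻¹ * profile t) =
      fun t => (-(X ^ 2 * (p - derivative p))).eval (1 - t)⁻¹ * profile t :=
  funext fun t => (hasDerivAt_polynomial_mul_profile p t).deriv

lemma exists_polynomial_deriv_profile :
    deriv profile = fun t => (-(X ^ 2) : ℝ[X]).eval (1 - t)⁻¹ * profile t := by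
  simpa using deriv_polynomial_mul_profile 1

lemma deriv_profile (t : ℝ) : deriv profile t = -((1 - t)⁻¹ ^ 2 * profile t) := by
  simp [exists_polynomial_deriv_profile]

lemma deriv_profile_nonpos (t : ℝ) : deriv profile t ≤ 0 := by
  rw [deriv_profile]
  have := profile_nonneg t
  simp only [Left.neg_nonpos_iff]
  positivity

lemma deriv_profile_neg {t : ℝ} (ht : t < 1) : deriv profile t < 0 := by
  rw [deriv_profile]
  have := profile_pos ht
  have : 0 < 1 - t := sub_pos.2 ht
  simp only [Left.neg_neg_iff]
  positivity

lemma deriv_profile_eq_zero {t : ℝ} (ht : 1 ≤ t) : deriv profile t = 0 := by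
  simp [deriv_profile, profile_eq_zero ht]

lemma deriv_deriv_profile_eq_zero {t : ℝ} (ht : 1 ≤ t) : deriv (deriv profile) t = 0 := by
  rw [exists_polynomial_deriv_profile, deriv_polynomial_mul_profile]
  simp [profile_eq_zero ht]

lemma contDiff_deriv_profile : ContDiff ℝ (⊤ : ℕ∞) (deriv profile) :=
  (contDiff_infty_iff_deriv.1 contDiff_profile).2

lemma hasDerivAt_profile (t : ℝ) : HasDerivAt profile (deriv profile t) t :=
  ((contDiff_profile (n := ⊤)).differentiable (by simp) t).hasDerivAt

lemma hasDerivAt_deriv_profile (t : ℝ) :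
    HasDerivAt (deriv profile) (deriv (deriv profile) t) t :=
  (contDiff_deriv_profile.differentiable (by simp) t).hasDerivAt

lemma continuous_deriv_profile : Continuous (deriv profile) := contDiff_deriv_profile.continuous

lemma continuous_deriv_deriv_profile : Continuous (deriv (deriv profile)) :=
  ((contDiff_infty_iff_deriv.1 contDiff_deriv_profile).2).continuous

lemma exists_abs_le_of_eq_zero {g : ℝ → ℝ} (hg : Continuous g) (h0 : ∀ t, 1 ≤ t → g t = 0) :
    ∃ C, 0 < C ∧ ∀ t, 0 ≤ t → |g t| ≤ C := by
  obtain ⟨C, hC⟩ := (isCompact_Icc (a := (0 : ℝ)) (b := 1)).exists_bound_of_continuousOn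
    hg.continuousOn
  refine ⟨max C 1, by positivity, fun t ht => ?_⟩
  rcases le_total t 1 with h | h
  · exact (hC t ⟨ht, h⟩).trans (le_max_left _ _)
  · rw [h0 t h, abs_zero]
    positivity

section Laplacian

variable {d : ℕ}

lemma hasFDerivAt_radial {g : ℝ → ℝ} {g' : ℝ} {x y : EuclideanSpace ℝ (Fin d)}
    (hg : HasDerivAt g g' (‖x - y‖ ^ 2)) :
    HasFDerivAt (fun x => g (‖x - y‖ ^ 2)) ((2 * g') • innerSL ℝ (x - y)) x := by
  have h1 : HasFDerivAt (fun x => ‖x - y‖ ^ 2) (2 • innerSL ℝ (x - y)) x := by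
    simpa using ((hasFDerivAt_id x).sub_const y).norm_sq
  refine (hg.comp_hasFDerivAt x h1).congr_fderiv ?_
  ext v
  simp
  ring

lemma laplacian_radial {g g' g'' : ℝ → ℝ} (hg : ∀ s, HasDerivAt g (g' s) s)
    (hg' : ∀ s, HasDerivAt g' (g'' s) s) (x y : EuclideanSpace ℝ (Fin d)) :
    laplacian (fun x => g (‖x - y‖ ^ 2)) x =
      4 * g'' (‖x - y‖ ^ 2) * ‖x - y‖ ^ 2 + 2 * d * g' (‖x - y‖ ^ 2) := by
  have h1 : fderiv ℝ (fun x => g (‖x - y‖ ^ 2)) =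
      fun x => (2 * g' (‖x - y‖ ^ 2)) • innerSL ℝ (x - y) :=
    funext fun x => (hasFDerivAt_radial (hg _)).fderiv
  have h2 : HasFDerivAt (fun x => (2 * g' (‖x - y‖ ^ 2)) • innerSL ℝ (x - y)) _ x :=
    ((hasFDerivAt_radial (hg' (‖x - y‖ ^ 2))).const_mul 2).smul
      ((innerSL ℝ).hasFDerivAt.comp x ((hasFDerivAt_id x).sub_const y))
  have h3 : ∀ i : Fin d, iteratedFDeriv ℝ 2 (fun x => g (‖x - y‖ ^ 2)) x
      ![EuclideanSpace.single i (1:ℝ), EuclideanSpace.single i (1:ℝ)] =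
      4 * g'' (‖x - y‖ ^ 2) * ((x - y) i) ^ 2 + 2 * g' (‖x - y‖ ^ 2) := by
    intro i
    have he : innerSL ℝ (EuclideanSpace.single i (1:ℝ)) (EuclideanSpace.single i (1:ℝ)) = 1 := by
      rw [innerSL_apply_apply]
      simp
    rw [iteratedFDeriv_two_apply, h1, h2.fderiv]
    simp [EuclideanSpace.inner_single_right, he]
    ring
  have h4 : ∑ i : Fin d, ((x - y) i) ^ 2 = ‖x - y‖ ^ 2 := by simp [EuclideanSpace.norm_sq_eq]
  simp only [laplacian, h3, Finset.sum_add_distrib, ← Finset.mul_sum, h4]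
  simp
  ring

lemma continuous_laplacian {f : EuclideanSpace ℝ (Fin d) → ℝ} (hf : ContDiff ℝ (⊤ : ℕ∞) f) :
    Continuous (laplacian f) := by
  have h := hf.continuous_iteratedFDeriv (m := 2) (by norm_cast)
  exact continuous_finsetSum _ fun i _ => (ContinuousMultilinearMap.apply ℝ
    (fun _ : Fin 2 => EuclideanSpace ℝ (Fin d)) ℝ
      ![EuclideanSpace.single i (1:ℝ), EuclideanSpace.single i (1:ℝ)]).continuous.comp h

lemma support_laplacian_subset (f : EuclideanSpace ℝ (Fin d) → ℝ) :
    Function.support (laplacian f) ⊆ tsupport f := by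
  intro x hx
  by_contra h
  refine hx (Finset.sum_eq_zero fun i _ => ?_)
  have : iteratedFDeriv ℝ 2 f x = 0 := by
    by_contra h'
    exact h (support_iteratedFDeriv_subset 2 h')
  simp [this]

lemma integral_laplacian_eq_zero {f : EuclideanSpace ℝ (Fin d) → ℝ}
    (hf : ContDiff ℝ (⊤ : ℕ∞) f) (hc : HasCompactSupport f) : ∫ x, laplacian f x = 0 := by
  have hf' : ContDiff ℝ (⊤ : ℕ∞) (fderiv ℝ f) := hf.fderiv_right (by simp)
  have key : ∀ v : EuclideanSpace ℝ (Fin d),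
      Integrable (fun x => iteratedFDeriv ℝ 2 f x ![v, v]) ∧
        ∫ x, iteratedFDeriv ℝ 2 f x ![v, v] = 0 := by
    intro v
    have hg : ContDiff ℝ (⊤ : ℕ∞) (fun x => fderiv ℝ f x v) := hf'.clm_apply contDiff_const
    have hgc : HasCompactSupport (fun x => fderiv ℝ f x v) := hc.fderiv_apply ℝ v
    have hgi : Integrable (fun x => fderiv ℝ f x v) :=
      hg.continuous.integrable_of_hasCompactSupport hgc
    have hgi' : Integrable (fun x => fderiv ℝ (fun x => fderiv ℝ f x v) x v) :=
      ((hg.fderiv_right (m := (⊤ : ℕ∞)) (by simp)).clm_apply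
        contDiff_const).continuous.integrable_of_hasCompactSupport (hgc.fderiv_apply ℝ v)
    have heq : (fun x => iteratedFDeriv ℝ 2 f x ![v, v]) =
        fun x => fderiv ℝ (fun x => fderiv ℝ f x v) x v := by
      ext x
      rw [iteratedFDeriv_two_apply, fderiv_clm_apply (hf'.differentiable (by simp) x) (by fun_prop)]
      simp
    have := integral_mul_fderiv_eq_neg_fderiv_mul_of_integrable (μ := volume)
      (f := fun _ => (1 : ℝ)) (g := fun x => fderiv ℝ f x v) (v := v) (by simp)
      (by simpa using hgi') (by simpa using hgi) (by fun_prop)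
      (fun x _ => hg.differentiable (by simp) x)
    rw [heq]
    exact ⟨hgi', by simpa using this⟩
  simp only [laplacian]
  rw [integral_finsetSum _ fun i _ => (key _).1]
  exact Finset.sum_eq_zero fun i _ => (key _).2

end Laplacian

section Kernel

variable {d : ℕ}

/-- The radial kernels `z ↦ radialKernel d t ‖z‖²`, a family of dilates of a bump function. -/
noncomputable def radialKernel (d : ℕ) (t s : ℝ) : ℝ := (t ^ d)⁻¹ * (-2 * deriv profile (s / t ^ 2))

/-- The profile of the Laplacian of `z ↦ profile ‖z‖²`. -/
noncomputable def laplacianProfile (d : ℕ) (u : ℝ) : ℝ :=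
  4 * deriv (deriv profile) u * u + 2 * d * deriv profile u

lemma continuous_laplacianProfile (d : ℕ) : Continuous (laplacianProfile d) := by
  have h1 := continuous_deriv_profile
  have h2 := continuous_deriv_deriv_profile
  unfold laplacianProfile
  fun_prop

lemma laplacianProfile_eq_zero (d : ℕ) {u : ℝ} (hu : 1 ≤ u) : laplacianProfile d u = 0 := by
  simp [laplacianProfile, deriv_profile_eq_zero hu, deriv_deriv_profile_eq_zero hu]

lemma hasDerivAt_radialKernel (d : ℕ) {t : ℝ} (ht : 0 < t) (s : ℝ) :
    HasDerivAt (fun t => radialKernel d t s)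
      (t * (t ^ d)⁻¹ * (t ^ 2)⁻¹ * laplacianProfile d (s / t ^ 2)) t := by
  have h1 : HasDerivAt (fun t : ℝ => (t ^ d)⁻¹) (-(d * t⁻¹ * (t ^ d)⁻¹)) t := by
    refine ((hasDerivAt_pow d t).fun_inv (by positivity)).congr_deriv ?_
    rcases d with _ | d
    · simp
    · simp only [Nat.add_sub_cancel]
      field_simp
      ring
  have h2 : HasDerivAt (fun t : ℝ => s / t ^ 2) (-(2 * s / t ^ 3)) t := by
    refine ((hasDerivAt_const t s).fun_div (hasDerivAt_pow 2 t) (by positivity)).congr_deriv ?_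
    field_simp
    simp
    ring
  refine (h1.fun_mul (((hasDerivAt_deriv_profile _).comp t h2).const_mul (-2))).congr_deriv ?_
  simp only [laplacianProfile, Function.comp_apply]
  field_simp
  ring

lemma laplacian_dilated_profile {t : ℝ} (ht : 0 < t) (c : ℝ) (x y : EuclideanSpace ℝ (Fin d)) :
    laplacian (fun x => c * profile (‖x - y‖ ^ 2 / t ^ 2)) x =
      c * (t ^ 2)⁻¹ * laplacianProfile d (‖x - y‖ ^ 2 / t ^ 2) := by
  have h : ∀ s : ℝ, HasDerivAt (fun s => s / t ^ 2) (t ^ 2)⁻¹ s := fun s => by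
    simpa using (hasDerivAt_id s).div_const (t ^ 2)
  rw [laplacian_radial (g := fun s => c * profile (s / t ^ 2))
    (fun s => ((hasDerivAt_profile _).comp s (h s)).const_mul c)
    (fun s => (((hasDerivAt_deriv_profile _).comp s (h s)).mul_const _).const_mul c)]
  simp only [laplacianProfile]
  field_simp

lemma contDiff_dilated_profile (t c : ℝ) (y : EuclideanSpace ℝ (Fin d)) :
    ContDiff ℝ (⊤ : ℕ∞) (fun x => c * profile (‖x - y‖ ^ 2 / t ^ 2)) :=
  contDiff_const.mul (contDiff_profile.comp
    (((contDiff_id.sub contDiff_const).norm_sq ℝ).div_const _))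

lemma one_le_norm_sq_div {t : ℝ} (ht : 0 < t) {x y : EuclideanSpace ℝ (Fin d)}
    (hx : x ∉ closedBall y t) : 1 ≤ ‖x - y‖ ^ 2 / t ^ 2 := by
  rw [mem_closedBall, dist_eq_norm, not_le] at hx
  rw [one_le_div (by positivity)]
  gcongr

lemma tsupport_dilated_profile_subset {t : ℝ} (ht : 0 < t) (c : ℝ)
    (y : EuclideanSpace ℝ (Fin d)) :
    tsupport (fun x => c * profile (‖x - y‖ ^ 2 / t ^ 2)) ⊆ closedBall y t := by
  refine closure_minimal (fun x hx => ?_) isClosed_closedBall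
  by_contra h
  exact hx (by simp [profile_eq_zero (one_le_norm_sq_div ht h)])

lemma hasCompactSupport_dilated_profile {t : ℝ} (ht : 0 < t) (c : ℝ)
    (y : EuclideanSpace ℝ (Fin d)) :
    HasCompactSupport (fun x => c * profile (‖x - y‖ ^ 2 / t ^ 2)) :=
  HasCompactSupport.of_support_subset_isCompact (isCompact_closedBall y t)
    ((subset_tsupport _).trans (tsupport_dilated_profile_subset ht c y))

lemma continuous_radialKernel (d : ℕ) (t : ℝ) : Continuous (radialKernel d t) := by
  have h1 := continuous_deriv_profile
  unfold radialKernel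
  fun_prop

lemma radialKernel_nonneg (d : ℕ) {t : ℝ} (ht : 0 < t) (s : ℝ) : 0 ≤ radialKernel d t s := by
  have := deriv_profile_nonpos (s / t ^ 2)
  have h : 0 ≤ -2 * deriv profile (s / t ^ 2) := by linarith
  unfold radialKernel
  positivity

lemma radialKernel_eq_zero {t : ℝ} (ht : 0 < t) {x y : EuclideanSpace ℝ (Fin d)}
    (hx : x ∉ closedBall y t) : radialKernel d t (‖x - y‖ ^ 2) = 0 := by
  simp [radialKernel, deriv_profile_eq_zero (one_le_norm_sq_div ht hx)]

lemma exists_radialKernel_le (d : ℕ) :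
    ∃ C, 0 < C ∧ ∀ t s, 0 < t → 0 ≤ s → radialKernel d t s ≤ C * (t ^ d)⁻¹ := by
  obtain ⟨C, hC, h⟩ := exists_abs_le_of_eq_zero continuous_deriv_profile
    fun t ht => deriv_profile_eq_zero ht
  refine ⟨2 * C, by positivity, fun t s ht hs => ?_⟩
  have := neg_le_of_abs_le (h (s / t ^ 2) (by positivity))
  rw [radialKernel, mul_comm]
  exact mul_le_mul_of_nonneg_right (by linarith) (by positivity)

lemma exists_le_radialKernel (d : ℕ) :
    ∃ c, 0 < c ∧ ∀ (t : ℝ) (x y : EuclideanSpace ℝ (Fin d)), 0 < t → x ∈ closedBall y (t / 2) →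
      c * (t ^ d)⁻¹ ≤ radialKernel d t (‖x - y‖ ^ 2) := by
  obtain ⟨u, hu, h⟩ := (isCompact_Icc (a := (0 : ℝ)) (b := 1 / 4)).exists_isMaxOn
    ⟨0, by norm_num⟩ continuous_deriv_profile.continuousOn
  have := deriv_profile_neg (t := u) (by linarith [hu.2])
  refine ⟨-2 * deriv profile u, by linarith, fun t x y ht hx => ?_⟩
  rw [mem_closedBall, dist_eq_norm] at hx
  have h1 : ‖x - y‖ ^ 2 / t ^ 2 ≤ 1 / 4 := by
    rw [div_le_iff₀ (by positivity)]
    nlinarith [norm_nonneg (x - y)]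
  have h2 : deriv profile (‖x - y‖ ^ 2 / t ^ 2) ≤ deriv profile u := h ⟨by positivity, h1⟩
  rw [radialKernel, mul_comm]
  gcongr ?_ * ?_
  linarith

/-- The common mass of the kernels `radialKernel d t`. -/
noncomputable def kernelMass (d : ℕ) : ℝ :=
  ∫ z : EuclideanSpace ℝ (Fin d), radialKernel d 1 (‖z‖ ^ 2)

lemma integral_radialKernel {t : ℝ} (ht : 0 < t) (y : EuclideanSpace ℝ (Fin d)) :
    ∫ z, radialKernel d t (‖z - y‖ ^ 2) = kernelMass d := by
  rw [integral_sub_right_eq_self (fun z : EuclideanSpace ℝ (Fin d) => radialKernel d t (‖z‖ ^ 2)) y]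
  have h := Measure.integral_comp_inv_smul_of_nonneg volume
    (fun z : EuclideanSpace ℝ (Fin d) => radialKernel d 1 (‖z‖ ^ 2)) ht.le
  have h2 : ∀ z : EuclideanSpace ℝ (Fin d), radialKernel d t (‖z‖ ^ 2) =
      (t ^ d)⁻¹ * radialKernel d 1 (‖t⁻¹ • z‖ ^ 2) := fun z => by
    simp [radialKernel, norm_smul, mul_pow, div_eq_inv_mul]
  simp only [h2, integral_const_mul, h, kernelMass]
  simp
  field_simp

lemma integrable_radialKernel {t : ℝ} (ht : 0 < t) (y : EuclideanSpace ℝ (Fin d)) :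
    Integrable (fun z => radialKernel d t (‖z - y‖ ^ 2)) := by
  refine Continuous.integrable_of_hasCompactSupport
    ((continuous_radialKernel d t).comp (by fun_prop)) ?_
  refine HasCompactSupport.intro (isCompact_closedBall y t) fun x hx => radialKernel_eq_zero ht hx

lemma kernelMass_pos (d : ℕ) : 0 < kernelMass d := by
  have h0 := integrable_radialKernel one_pos (0 : EuclideanSpace ℝ (Fin d))
  simp only [sub_zero] at h0
  obtain ⟨c, hc, h⟩ := exists_le_radialKernel d
  rw [kernelMass, integral_pos_iff_support_of_nonneg
    (fun z => radialKernel_nonneg d one_pos _) h0]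
  refine (measure_closedBall_pos volume (0 : EuclideanSpace ℝ (Fin d))
    (show (0 : ℝ) < 1 / 2 by norm_num)).trans_le (measure_mono fun x hx => ?_)
  have := h 1 x 0 one_pos hx
  simp only [one_pow, inv_one, mul_one, sub_zero] at this
  exact (hc.trans_le this).ne'

lemma integrable_mul_radialKernel {f : EuclideanSpace ℝ (Fin d) → ℝ} (hf : Integrable f)
    {t : ℝ} (ht : 0 < t) (y : EuclideanSpace ℝ (Fin d)) :
    Integrable (fun z => f z * radialKernel d t (‖z - y‖ ^ 2)) := by
  obtain ⟨C, hC, h⟩ := exists_radialKernel_le d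
  refine hf.mul_bdd (c := C * (t ^ d)⁻¹)
    ((continuous_radialKernel d t).comp (by fun_prop)).aestronglyMeasurable
    (ae_of_all _ fun z => ?_)
  rw [Real.norm_of_nonneg (radialKernel_nonneg d ht _)]
  exact h _ _ ht (by positivity)

end Kernel

section MeanValue

variable {d : ℕ} {f : EuclideanSpace ℝ (Fin d) → ℝ} {ν : Measure (EuclideanSpace ℝ (Fin d))}
  {B : Set (EuclideanSpace ℝ (Fin d))}

/-- The distributional Laplacian of `f` on `B` is the measure `ν`. -/
def HasDistribLaplacianOn (f : EuclideanSpace ℝ (Fin d) → ℝ)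
    (ν : Measure (EuclideanSpace ℝ (Fin d))) (B : Set (EuclideanSpace ℝ (Fin d))) : Prop :=
  ∀ ϕ : EuclideanSpace ℝ (Fin d) → ℝ, ContDiff ℝ (⊤ : ℕ∞) ϕ → HasCompactSupport ϕ →
    tsupport ϕ ⊆ B → ∫ x, f x * laplacian ϕ x = ∫ x, ϕ x ∂ν

lemma hasDerivAt_integral_radialKernel (hf : Integrable f) (h : HasDistribLaplacianOn f ν B)
    {y : EuclideanSpace ℝ (Fin d)} {t : ℝ} (ht : 0 < t) (hB : closedBall y t ⊆ B) :
    HasDerivAt (fun t => ∫ z, f z * radialKernel d t (‖z - y‖ ^ 2))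
      (∫ z, t * (t ^ d)⁻¹ * profile (‖z - y‖ ^ 2 / t ^ 2) ∂ν) t := by
  obtain ⟨C, hC, hbound⟩ := exists_abs_le_of_eq_zero (continuous_laplacianProfile d)
    fun u hu => laplacianProfile_eq_zero d hu
  have hcont : ∀ t : ℝ, Continuous fun z : EuclideanSpace ℝ (Fin d) =>
      t * (t ^ d)⁻¹ * (t ^ 2)⁻¹ * laplacianProfile d (‖z - y‖ ^ 2 / t ^ 2) := fun t =>
    continuous_const.mul ((continuous_laplacianProfile d).comp (by fun_prop))
  have key := (hasDerivAt_integral_of_dominated_loc_of_deriv_le (μ := volume)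
    (F := fun t z => f z * radialKernel d t (‖z - y‖ ^ 2))
    (F' := fun t z => f z *
      (t * (t ^ d)⁻¹ * (t ^ 2)⁻¹ * laplacianProfile d (‖z - y‖ ^ 2 / t ^ 2)))
    (bound := fun z => |f z| * (2 * t * ((t / 2) ^ d)⁻¹ * ((t / 2) ^ 2)⁻¹ * C))
    (Ioo_mem_nhds (show t / 2 < t by linarith) (show t < 2 * t by linarith))
    (by
      filter_upwards [lt_mem_nhds ht] with r hr
      exact (integrable_mul_radialKernel hf hr y).aestronglyMeasurable)
    (integrable_mul_radialKernel hf ht y)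
    (hf.aestronglyMeasurable.mul (hcont t).aestronglyMeasurable)
    (ae_of_all _ fun z r hr => by
      have hr0 : 0 < r := by linarith [hr.1]
      have h1 := hbound (‖z - y‖ ^ 2 / r ^ 2) (by positivity)
      rw [norm_mul, norm_mul, Real.norm_eq_abs, Real.norm_eq_abs, Real.norm_eq_abs,
        abs_of_pos (show 0 < r * (r ^ d)⁻¹ * (r ^ 2)⁻¹ by positivity)]
      have h2 := hr.1.le
      have h3 := hr.2.le
      gcongr)
    (hf.abs.mul_const _)
    (ae_of_all _ fun z r hr =>
      (hasDerivAt_radialKernel d (by linarith [hr.1]) (‖z - y‖ ^ 2)).const_mul (f z))).2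
  rw [← h _ (contDiff_dilated_profile t _ y) (hasCompactSupport_dilated_profile ht _ y)
    ((tsupport_dilated_profile_subset ht _ y).trans hB)]
  simpa only [laplacian_dilated_profile ht] using key

lemma monotoneOn_integral_radialKernel (hf : Integrable f) (h : HasDistribLaplacianOn f ν B)
    {y : EuclideanSpace ℝ (Fin d)} {R : ℝ} (hB : closedBall y R ⊆ B) :
    MonotoneOn (fun t => ∫ z, f z * radialKernel d t (‖z - y‖ ^ 2)) (Ioc 0 R) := by
  have hd : ∀ t ∈ Ioc 0 R, HasDerivAt (fun t => ∫ z, f z * radialKernel d t (‖z - y‖ ^ 2))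
      (∫ z, t * (t ^ d)⁻¹ * profile (‖z - y‖ ^ 2 / t ^ 2) ∂ν) t := fun t ht =>
    hasDerivAt_integral_radialKernel hf h ht.1 ((closedBall_subset_closedBall ht.2).trans hB)
  refine monotoneOn_of_deriv_nonneg (convex_Ioc 0 R)
    (fun t ht => (hd t ht).continuousAt.continuousWithinAt)
    (fun t ht => (hd t (interior_subset ht)).differentiableAt.differentiableWithinAt) ?_
  intro t ht
  have ht' := interior_subset ht
  rw [(hd t ht').deriv]
  refine integral_nonneg fun z => ?_
  have := ht'.1
  have := profile_nonneg (‖z - y‖ ^ 2 / t ^ 2)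
  positivity

lemma ae_tendsto_integral_radialKernel (hf : Integrable f) :
    ∀ᵐ y, Tendsto (fun t => ∫ z, f z * radialKernel d t (‖z - y‖ ^ 2)) (𝓝[>] 0)
      (𝓝 (kernelMass d * f y)) := by
  obtain ⟨C, hC, hbound⟩ := exists_radialKernel_le d
  filter_upwards [(Besicovitch.vitaliFamily volume).ae_tendsto_average_norm_sub
    hf.locallyIntegrable] with y hy
  have hy' := (hy.comp (Besicovitch.tendsto_filterAt volume y)).const_mul
    (C * volume.real (closedBall (0 : EuclideanSpace ℝ (Fin d)) 1))
  rw [mul_zero] at hy'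
  rw [tendsto_iff_norm_sub_tendsto_zero]
  refine squeeze_zero' (Eventually.of_forall fun _ => norm_nonneg _) ?_ hy'
  filter_upwards [self_mem_nhdsWithin] with t ht
  rw [mem_Ioi] at ht
  have hi := integrable_mul_radialKernel hf ht y
  have hi' : Integrable (fun z => f y * radialKernel d t (‖z - y‖ ^ 2)) :=
    (integrable_radialKernel ht y).const_mul _
  have hint : IntegrableOn (fun z => ‖f z - f y‖) (closedBall y t) :=
    (hf.integrableOn.sub (integrableOn_const
      (isCompact_closedBall y t).measure_lt_top.ne)).norm
  have h1 : ∫ z, f z * radialKernel d t (‖z - y‖ ^ 2) - f y * radialKernel d t (‖z - y‖ ^ 2) =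
      ∫ z in closedBall y t, (f z - f y) * radialKernel d t (‖z - y‖ ^ 2) := by
    rw [setIntegral_eq_integral_of_forall_compl_eq_zero
      fun z hz => by rw [radialKernel_eq_zero ht hz, mul_zero]]
    simp only [sub_mul]
  rw [← integral_radialKernel ht y, mul_comm, ← integral_const_mul, ← integral_sub hi hi', h1]
  calc ‖∫ z in closedBall y t, (f z - f y) * radialKernel d t (‖z - y‖ ^ 2)‖
      ≤ ∫ z in closedBall y t, ‖f z - f y‖ * (C * (t ^ d)⁻¹) := by
        refine norm_integral_le_of_norm_le (hint.mul_const _) (ae_of_all _ fun z => ?_)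
        rw [norm_mul, Real.norm_of_nonneg (radialKernel_nonneg d ht _)]
        gcongr
        exact hbound _ _ ht (by positivity)
    _ = _ := by
        have hv : 0 < volume.real (closedBall (0 : EuclideanSpace ℝ (Fin d)) 1) :=
          ENNReal.toReal_pos (measure_closedBall_pos volume _ one_pos).ne'
            (isCompact_closedBall _ _).measure_lt_top.ne
        simp only [Function.comp_apply, setAverage_eq,
          Measure.addHaar_real_closedBall' volume y ht.le, integral_mul_const, smul_eq_mul,
          finrank_euclideanSpace, Fintype.card_fin]
        field_simp

lemma ae_le_integral_radialKernel (hf : Integrable f) (h : HasDistribLaplacianOn f ν B) :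
    ∀ᵐ y, ∀ t, 0 < t → closedBall y t ⊆ B →
      kernelMass d * f y ≤ ∫ z, f z * radialKernel d t (‖z - y‖ ^ 2) := by
  filter_upwards [ae_tendsto_integral_radialKernel hf] with y hy t ht hB
  refine le_of_tendsto hy ?_
  filter_upwards [Ioc_mem_nhdsGT ht] with s hs
  exact monotoneOn_integral_radialKernel hf h hB hs ⟨ht, le_rfl⟩ hs.2

/-- Local boundedness from above of subharmonic functions. -/
lemma exists_ae_le_setIntegral (d : ℕ) : ∃ C, 0 < C ∧
    ∀ {f : EuclideanSpace ℝ (Fin d) → ℝ} {ν : Measure (EuclideanSpace ℝ (Fin d))}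
      {B : Set (EuclideanSpace ℝ (Fin d))}, Integrable f → HasDistribLaplacianOn f ν B →
      ∀ᵐ y, ∀ t, 0 < t → closedBall y t ⊆ B →
        f y ≤ C * (t ^ d)⁻¹ * ∫ z in closedBall y t, max (f z) 0 := by
  obtain ⟨C, hC, hbound⟩ := exists_radialKernel_le d
  have hm := kernelMass_pos d
  refine ⟨C / kernelMass d, by positivity, fun {f ν B} hf h => ?_⟩
  filter_upwards [ae_le_integral_radialKernel hf h] with y hy t ht hB
  have h1 : ∫ z, f z * radialKernel d t (‖z - y‖ ^ 2) ≤
      ∫ z in closedBall y t, max (f z) 0 * (C * (t ^ d)⁻¹) := by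
    rw [← setIntegral_eq_integral_of_forall_compl_eq_zero (s := closedBall y t)
      fun z hz => by rw [radialKernel_eq_zero ht hz, mul_zero]]
    refine integral_mono (integrable_mul_radialKernel hf ht y).integrableOn
      (hf.pos_part.integrableOn.mul_const _) fun z => ?_
    exact mul_le_mul (le_max_left _ _) (hbound _ _ ht (by positivity))
      (radialKernel_nonneg d ht _) (le_max_right _ _)
  rw [integral_mul_const] at h1
  have h2 := (hy t ht hB).trans h1
  rw [mul_comm, ← le_div_iff₀ hm] at h2
  exact h2.trans_eq (by ring)

/-- The weak Harnack inequality for subharmonic functions bounded above. -/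
lemma exists_ae_setIntegral_le (d : ℕ) : ∃ C, 0 < C ∧
    ∀ {f : EuclideanSpace ℝ (Fin d) → ℝ} {ν : Measure (EuclideanSpace ℝ (Fin d))}
      {B : Set (EuclideanSpace ℝ (Fin d))}, Integrable f → HasDistribLaplacianOn f ν B →
      ∀ᵐ y, ∀ t M, 0 < t → closedBall y t ⊆ B → (∀ᵐ z, z ∈ closedBall y t → f z ≤ M) →
        ∫ z in closedBall y (t / 2), (M - f z) ≤ C * t ^ d * (M - f y) := by
  obtain ⟨c, hc, hbound⟩ := exists_le_radialKernel d
  have hm := kernelMass_pos d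
  refine ⟨kernelMass d / c, by positivity, fun {f ν B} hf h => ?_⟩
  filter_upwards [ae_le_integral_radialKernel hf h] with y hy t M ht hB hM
  have hi := integrable_mul_radialKernel hf ht y
  have hi' : Integrable (fun z => M * radialKernel d t (‖z - y‖ ^ 2)) :=
    (integrable_radialKernel ht y).const_mul _
  have h1 : ∫ z in closedBall y (t / 2), (M - f z) * (c * (t ^ d)⁻¹) ≤
      ∫ z, (M * radialKernel d t (‖z - y‖ ^ 2) - f z * radialKernel d t (‖z - y‖ ^ 2)) := by
    rw [← integral_indicator isClosed_closedBall.measurableSet]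
    refine integral_mono_ae ?_ (hi'.sub hi) ?_
    · rw [integrable_indicator_iff isClosed_closedBall.measurableSet]
      exact ((integrableOn_const (isCompact_closedBall y _).measure_lt_top.ne).sub
        hf.integrableOn).mul_const _
    · filter_upwards [hM] with z hz
      rw [← sub_mul]
      by_cases hzt : z ∈ closedBall y t
      · have hz0 : 0 ≤ M - f z := sub_nonneg.2 (hz hzt)
        by_cases hz2 : z ∈ closedBall y (t / 2)
        · rw [indicator_of_mem hz2]
          exact mul_le_mul_of_nonneg_left (hbound t z y ht hz2) hz0
        · rw [indicator_of_notMem hz2]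
          exact mul_nonneg hz0 (radialKernel_nonneg d ht _)
      · rw [indicator_of_notMem fun hz2 =>
          hzt (closedBall_subset_closedBall (by linarith) hz2), radialKernel_eq_zero ht hzt,
          mul_zero]
  rw [integral_mul_const, integral_sub hi' hi, integral_const_mul, integral_radialKernel ht y]
    at h1
  have h2 : (∫ z in closedBall y (t / 2), (M - f z)) * (c * (t ^ d)⁻¹) ≤
      kernelMass d * (M - f y) := by linarith [hy t ht hB]
  rw [← le_div_iff₀ (by positivity)] at h2
  exact h2.trans_eq (by field_simp)

end MeanValue

section Density

variable {d : ℕ}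

lemma exists_measureReal_closedBall_le (d : ℕ) : ∃ K, 0 < K ∧
    ∀ {f : EuclideanSpace ℝ (Fin d) → ℝ} {ν : Measure (EuclideanSpace ℝ (Fin d))}
      [IsFiniteMeasure ν] {B : Set (EuclideanSpace ℝ (Fin d))},
      Integrable f → HasDistribLaplacianOn f ν B → ∀ x r M, 0 < r → closedBall x r ⊆ B → 0 ≤ M →
      (∀ᵐ z, z ∈ closedBall x r → f z ≤ M) →
      (∃ᶠ y in ae volume, y ∈ closedBall x (r / 8) ∧ f y = 0) →
      ν.real (closedBall x (r / 16)) ≤ K * (r ^ d * (r ^ 2)⁻¹ * M) := by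
  obtain ⟨C, hC, hharnack⟩ := exists_ae_setIntegral_le d
  obtain ⟨C', hC', hbound⟩ := exists_abs_le_of_eq_zero (continuous_laplacianProfile d)
    fun u hu => laplacianProfile_eq_zero d hu
  set ω := volume.real (closedBall (0 : EuclideanSpace ℝ (Fin d)) 1) with hω
  have hω0 : 0 ≤ ω := measureReal_nonneg
  have hp : 0 < profile (1 / 4) := profile_pos (by norm_num)
  refine ⟨64 * C' * (C + ω) / profile (1 / 4), by positivity,
    fun {f ν} _ {B} hf h x r M hr hB hM hfM hfreq => ?_⟩
  have hrpos : 0 < r / 8 := by positivity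
  obtain ⟨y, ⟨hyx, hy0⟩, hy⟩ := (hfreq.and_eventually (hharnack hf h)).exists
  have hyr : closedBall y (r / 2) ⊆ closedBall x r :=
    closedBall_subset_closedBall' (by rw [mem_closedBall] at hyx; linarith)
  have hxy : closedBall x (r / 8) ⊆ closedBall y (r / 2 / 2) :=
    closedBall_subset_closedBall' (by rw [mem_closedBall, dist_comm] at hyx; linarith)
  have hint : ∀ z s, IntegrableOn (fun z => M - f z) (closedBall z s) := fun z s =>
    (integrableOn_const (isCompact_closedBall z _).measure_lt_top.ne).sub hf.integrableOn
  have h1 : ∫ z in closedBall x (r / 8), (M - f z) ≤ C * r ^ d * M := by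
    calc _ ≤ ∫ z in closedBall y (r / 2 / 2), (M - f z) := by
          refine setIntegral_mono_set (hint _ _) ?_ (ae_of_all _ hxy)
          rw [EventuallyLE, ae_restrict_iff' isClosed_closedBall.measurableSet]
          filter_upwards [hfM] with z hz hzy
          exact sub_nonneg.2 (hz (hyr (closedBall_subset_closedBall (by linarith) hzy)))
      _ ≤ C * (r / 2) ^ d * (M - f y) := hy _ M (by positivity) (hyr.trans hB)
          (by filter_upwards [hfM] with z hz hzy using hz (hyr hzy))
      _ ≤ _ := by
          rw [hy0, sub_zero]
          gcongr
          linarith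
  have h2 : ∫ z in closedBall x (r / 8), |f z| ≤ (C + ω) * r ^ d * M := by
    have h3 : ∫ z in closedBall x (r / 8), |f z| ≤
        ∫ z in closedBall x (r / 8), ((M - f z) + M) := by
      refine setIntegral_mono_on_ae hf.abs.integrableOn ((hint _ _).add
        (integrableOn_const (isCompact_closedBall x _).measure_lt_top.ne))
        isClosed_closedBall.measurableSet ?_
      filter_upwards [hfM] with z hz hzx
      have := hz (closedBall_subset_closedBall (by linarith) hzx)
      exact abs_le.2 ⟨by linarith, by linarith⟩
    rw [integral_add (hint _ _) (integrableOn_const (isCompact_closedBall x _).measure_lt_top.ne),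
      setIntegral_const, Measure.addHaar_real_closedBall' volume x hrpos.le, ← hω,
      finrank_euclideanSpace, Fintype.card_fin, smul_eq_mul] at h3
    have h4 : (r / 8) ^ d * ω * M ≤ r ^ d * ω * M := by
      gcongr
      linarith
    linarith
  have h5 := h _ (contDiff_dilated_profile (r / 8) 1 x) (hasCompactSupport_dilated_profile hrpos 1 x)
    ((tsupport_dilated_profile_subset hrpos 1 x).trans
      ((closedBall_subset_closedBall (by linarith)).trans hB))
  simp only [laplacian_dilated_profile hrpos] at h5
  simp only [one_mul] at h5
  have hbd : Integrable (fun z => profile (‖z - x‖ ^ 2 / (r / 8) ^ 2)) ν := by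
    have := contDiff_dilated_profile (r / 8) 1 x
    simp only [one_mul] at this
    refine Integrable.of_bound (C := profile 0) this.continuous.aestronglyMeasurable
      (ae_of_all _ fun z => ?_)
    rw [Real.norm_of_nonneg (profile_nonneg _)]
    exact profile_antitone (by positivity)
  have h6 : ν.real (closedBall x (r / 16)) * profile (1 / 4) ≤
      ∫ z, profile (‖z - x‖ ^ 2 / (r / 8) ^ 2) ∂ν := by
    rw [← smul_eq_mul, ← setIntegral_const]
    refine (setIntegral_mono_on (integrableOn_const (measure_lt_top _ _).ne) hbd.integrableOn
      isClosed_closedBall.measurableSet fun z hz => ?_).trans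
      (setIntegral_le_integral hbd (ae_of_all _ fun z => profile_nonneg _))
    apply profile_antitone
    rw [mem_closedBall, dist_eq_norm] at hz
    rw [div_le_iff₀ (by positivity)]
    nlinarith [norm_nonneg (z - x)]
  have h7 : ∫ z, f z * (((r / 8) ^ 2)⁻¹ * laplacianProfile d (‖z - x‖ ^ 2 / (r / 8) ^ 2)) ≤
      (∫ z in closedBall x (r / 8), |f z|) * (((r / 8) ^ 2)⁻¹ * C') := by
    rw [← integral_mul_const, ← setIntegral_eq_integral_of_forall_compl_eq_zero
      (s := closedBall x (r / 8)) fun z hz => by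
        rw [laplacianProfile_eq_zero d (one_le_norm_sq_div hrpos hz), mul_zero, mul_zero]]
    refine (Real.le_norm_self _).trans (norm_integral_le_of_norm_le (hf.abs.mul_const _).integrableOn
      (ae_of_all _ fun z => ?_))
    rw [norm_mul, norm_mul, Real.norm_eq_abs, Real.norm_eq_abs, Real.norm_eq_abs,
      abs_of_pos (show 0 < ((r / 8) ^ 2)⁻¹ by positivity)]
    gcongr
    exact hbound _ (by positivity)
  have h8 : ν.real (closedBall x (r / 16)) * profile (1 / 4) ≤
      (C + ω) * r ^ d * M * (((r / 8) ^ 2)⁻¹ * C') :=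
    (h6.trans_eq h5.symm).trans (h7.trans (by gcongr))
  rw [← le_div_iff₀ hp] at h8
  refine h8.trans_eq ?_
  field_simp
  ring

lemma exists_ae_le_of_density (d : ℕ) : ∃ δ C : ℝ, 0 < δ ∧ 0 < C ∧
    ∀ {f : EuclideanSpace ℝ (Fin d) → ℝ} {ν : Measure (EuclideanSpace ℝ (Fin d))}
      {B : Set (EuclideanSpace ℝ (Fin d))}, Measurable f → Integrable f →
      HasDistribLaplacianOn f ν B → ∀ x r, 0 < r → closedBall x (2 * r) ⊆ B →
      (∀ s, 0 < s → s ≤ r → volume.real ({z | f z = 0}ᶜ ∩ closedBall x s) ≤ δ * s ^ d) →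
      ∀ k : ℕ, ∀ᵐ z, z ∈ closedBall x (r / 2 ^ (k + 1)) →
        f z ≤ C * ((r / 2 ^ (k + 1)) ^ d)⁻¹ * (1 / 2 ^ (d + 3)) ^ k *
          ∫ z in closedBall x r, max (f z) 0 := by
  obtain ⟨C, hC, hmean⟩ := exists_ae_le_setIntegral d
  refine ⟨1 / 2 ^ (d + 3) / C, C, by positivity, hC, fun {f ν B} hfm hf h x r hr hB hδ => ?_⟩
  set I : ℝ → ℝ := fun s => ∫ z in closedBall x s, max (f z) 0 with hI
  have hI0 : ∀ s, 0 ≤ I s := fun s => integral_nonneg fun z => le_max_right _ _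
  have hsup : ∀ s, 0 < s → s ≤ r → ∀ᵐ z, z ∈ closedBall x s → f z ≤ C * (s ^ d)⁻¹ * I (2 * s) := by
    intro s hs hsr
    filter_upwards [hmean hf h] with y hy hyx
    have hsub : closedBall y s ⊆ closedBall x (2 * s) :=
      closedBall_subset_closedBall' (by rw [mem_closedBall] at hyx; linarith)
    refine (hy s hs (hsub.trans
      ((closedBall_subset_closedBall (by linarith)).trans hB))).trans ?_
    gcongr
    exact setIntegral_mono_set hf.pos_part.integrableOn
      (ae_of_all _ fun z => le_max_right _ _) (ae_of_all _ hsub)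
  have hstep : ∀ s, 0 < s → s ≤ r → I s ≤ 1 / 2 ^ (d + 3) * I (2 * s) := by
    intro s hs hsr
    have hm : MeasurableSet {z | f z = 0}ᶜ := (hfm (measurableSet_singleton 0)).compl
    have hfin : volume ({z | f z = 0}ᶜ ∩ closedBall x s) ≠ ⊤ :=
      measure_ne_top_of_subset inter_subset_right (isCompact_closedBall x s).measure_lt_top.ne
    calc I s = ∫ z in {z | f z = 0}ᶜ ∩ closedBall x s, max (f z) 0 := by
          have h0 : ∀ z ∈ closedBall x s \ ({z | f z = 0}ᶜ ∩ closedBall x s), max (f z) 0 = 0 := by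
            intro z hz
            have : f z = 0 := by
              by_contra h'
              exact hz.2 ⟨h', hz.1⟩
            simp [this]
          exact setIntegral_eq_of_subset_of_forall_sdiff_eq_zero
            isClosed_closedBall.measurableSet inter_subset_right h0
      _ ≤ ∫ z in {z | f z = 0}ᶜ ∩ closedBall x s, C * (s ^ d)⁻¹ * I (2 * s) := by
          refine setIntegral_mono_on_ae hf.pos_part.integrableOn (integrableOn_const hfin)
            (hm.inter isClosed_closedBall.measurableSet) ?_
          filter_upwards [hsup s hs hsr] with z hz hzs
          exact max_le (hz hzs.2) (by have := hI0 (2 * s); positivity)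
      _ = volume.real ({z | f z = 0}ᶜ ∩ closedBall x s) * (C * (s ^ d)⁻¹ * I (2 * s)) := by
          rw [setIntegral_const, smul_eq_mul]
      _ ≤ (1 / 2 ^ (d + 3) / C * s ^ d) * (C * (s ^ d)⁻¹ * I (2 * s)) := by
          have := hI0 (2 * s)
          gcongr
          exact hδ s hs hsr
      _ = _ := by field_simp
  have hiter : ∀ k : ℕ, I (r / 2 ^ k) ≤ (1 / 2 ^ (d + 3)) ^ k * I r := by
    intro k
    induction k with
    | zero => simp
    | succ k ih =>
      have h1 := hstep (r / 2 ^ (k + 1)) (by positivity)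
        (div_le_self hr.le (one_le_pow₀ one_le_two))
      have h2 : 2 * (r / 2 ^ (k + 1)) = r / 2 ^ k := by
        field_simp
        ring
      rw [h2] at h1
      calc _ ≤ _ := h1
        _ ≤ 1 / 2 ^ (d + 3) * ((1 / 2 ^ (d + 3)) ^ k * I r) := by gcongr
        _ = _ := by ring
  intro k
  filter_upwards [hsup (r / 2 ^ (k + 1)) (by positivity)
    (div_le_self hr.le (one_le_pow₀ one_le_two))] with z hz hzk
  have h2 : 2 * (r / 2 ^ (k + 1)) = r / 2 ^ k := by
    field_simp
    ring
  refine (hz hzk).trans ?_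
  rw [h2, mul_assoc _ _ (I r)]
  gcongr
  exact hiter k

lemma ae_rnDeriv_eq_zero {f : EuclideanSpace ℝ (Fin d) → ℝ}
    {ν : Measure (EuclideanSpace ℝ (Fin d))} [IsFiniteMeasure ν]
    {B : Set (EuclideanSpace ℝ (Fin d))} (hB : IsOpen B) (hfm : Measurable f)
    (hf : Integrable f) (h : HasDistribLaplacianOn f ν B) :
    ∀ᵐ x, x ∈ B → f x = 0 → ν.rnDeriv volume x = 0 := by
  obtain ⟨K, hK, hdecay⟩ := exists_measureReal_closedBall_le d
  obtain ⟨δ, C, hδ, hC, hsup⟩ := exists_ae_le_of_density d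
  set ω := volume.real (closedBall (0 : EuclideanSpace ℝ (Fin d)) 1) with hω
  have hω0 : 0 < ω := ENNReal.toReal_pos (measure_closedBall_pos volume _ one_pos).ne'
    (isCompact_closedBall _ _).measure_lt_top.ne
  have hvol : ∀ (x : EuclideanSpace ℝ (Fin d)) (s : ℝ), 0 ≤ s →
      volume.real (closedBall x s) = s ^ d * ω := fun x s hs => by
    rw [Measure.addHaar_real_closedBall' volume x hs, finrank_euclideanSpace, Fintype.card_fin]
  have hE : MeasurableSet {z | f z = 0}ᶜ := (hfm (measurableSet_singleton 0)).compl
  set ε := min (δ / ω) (1 / 2) with hε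
  have hε0 : 0 < ε := by positivity
  filter_upwards [Besicovitch.ae_tendsto_rnDeriv ν volume,
    Besicovitch.ae_tendsto_measure_inter_div_of_measurableSet volume hE] with x hx1 hx2 hxB hx0
  rw [indicator_of_notMem (by simpa using hx0)] at hx2
  have hdens : ∀ᶠ s in 𝓝[>] (0 : ℝ),
      volume.real ({z | f z = 0}ᶜ ∩ closedBall x s) ≤ ε * (s ^ d * ω) := by
    filter_upwards [hx2.eventually_lt_const (ENNReal.ofReal_pos.2 hε0), self_mem_nhdsWithin]
      with s hs hs0
    rw [mem_Ioi] at hs0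
    have h1 := ENNReal.toReal_mono ENNReal.ofReal_ne_top hs.le
    rw [ENNReal.toReal_div, ENNReal.toReal_ofReal hε0.le] at h1
    change volume.real _ / volume.real _ ≤ ε at h1
    rw [hvol x s hs0.le] at h1
    rwa [← div_le_iff₀ (by positivity)]
  obtain ⟨r₁, hr₁, hr₁'⟩ := mem_nhdsGT_iff_exists_Ioc_subset.1 hdens
  obtain ⟨r₂, hr₂, hr₂'⟩ := nhds_basis_closedBall.mem_iff.1 (hB.mem_nhds hxB)
  rw [mem_Ioi] at hr₁
  set r := min r₁ (r₂ / 2) with hr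
  have hr0 : 0 < r := by positivity
  have hrB : closedBall x (2 * r) ⊆ B :=
    (closedBall_subset_closedBall (by linarith [min_le_right r₁ (r₂ / 2)])).trans hr₂'
  have hdens' : ∀ s, 0 < s → s ≤ r →
      volume.real ({z | f z = 0}ᶜ ∩ closedBall x s) ≤ ε * (s ^ d * ω) := fun s hs hsr =>
    hr₁' ⟨hs, hsr.trans (min_le_left _ _)⟩
  set I := ∫ z in closedBall x r, max (f z) 0
  have hI : 0 ≤ I := integral_nonneg fun z => le_max_right _ _
  have hM : ∀ k : ℕ, ∀ᵐ z, z ∈ closedBall x (r / 2 ^ (k + 1)) →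
      f z ≤ C * ((r / 2 ^ (k + 1)) ^ d)⁻¹ * (1 / 2 ^ (d + 3)) ^ k * I := by
    refine hsup hfm hf h x r hr0 hrB fun s hs hsr => (hdens' s hs hsr).trans ?_
    calc ε * (s ^ d * ω) ≤ δ / ω * (s ^ d * ω) := by
          gcongr
          exact min_le_left _ _
      _ = _ := by field_simp
  have hfreq : ∀ s, 0 < s → s ≤ r → ∃ᶠ y in ae volume, y ∈ closedBall x s ∧ f y = 0 := by
    intro s hs hsr hcon
    have h1 : ({z | f z = 0}ᶜ ∩ closedBall x s : Set _) =ᵐ[volume] closedBall x s := by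
      rw [eventuallyEq_set]
      filter_upwards [hcon] with y hy
      exact ⟨fun h => h.2, fun h => ⟨fun h' => hy ⟨h, h'⟩, h⟩⟩
    have h2 := hdens' s hs hsr
    rw [measureReal_congr h1, hvol x s hs.le] at h2
    have h3 : ε ≤ 1 / 2 := min_le_right _ _
    have h4 : 0 < s ^ d * ω := by positivity
    nlinarith
  set K' := K * C * I * 16 ^ d * 2 ^ (d + 2) / (r ^ (d + 2) * ω) with hK'
  have hν : ∀ k : ℕ, ν.real (closedBall x (r / 2 ^ (k + 1) / 16)) /
      volume.real (closedBall x (r / 2 ^ (k + 1) / 16)) ≤ K' * (1 / 2) ^ k := by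
    intro k
    have hle : r / 2 ^ (k + 1) ≤ r := div_le_self hr0.le (one_le_pow₀ one_le_two)
    have hpos : 0 < r / 2 ^ (k + 1) := by positivity
    rw [hvol x _ (by positivity), div_le_iff₀ (by positivity)]
    refine (hdecay hf h x (r / 2 ^ (k + 1)) _ hpos
      ((closedBall_subset_closedBall (by linarith)).trans hrB) (by positivity) (hM k)
      (hfreq _ (by positivity) (by linarith))).trans_eq ?_
    have hpow : (1 / 2 ^ (d + 3) : ℝ) ^ k = ((2 ^ k) ^ d)⁻¹ * ((2 ^ k) ^ 3)⁻¹ := by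
      rw [one_div, inv_pow, ← mul_inv, pow_add, mul_pow, ← pow_mul, ← pow_mul, ← pow_mul,
        ← pow_mul, mul_comm d, mul_comm 3]
    have ha : (0 : ℝ) < 2 ^ k := by positivity
    rw [hK', hpow, div_pow 1 2 k, one_pow, pow_succ 2 k]
    generalize (2 : ℝ) ^ k = a at ha
    simp only [div_pow, mul_pow]
    field_simp
    ring
  have hseq : Tendsto (fun k : ℕ => r / 2 ^ (k + 1) / 16) atTop (𝓝[>] 0) := by
    refine tendsto_nhdsWithin_iff.2 ⟨?_, Eventually.of_forall fun k => ?_⟩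
    · have h1 := (tendsto_pow_atTop_nhds_zero_of_lt_one (r := (1 / 2 : ℝ)) (by norm_num)
        (by norm_num)).const_mul (r / 32)
      rw [mul_zero] at h1
      refine h1.congr fun k => ?_
      rw [div_pow, one_pow, pow_succ]
      field_simp
      norm_num
    · exact mem_Ioi.2 (by positivity)
  refine tendsto_nhds_unique (hx1.comp hseq) ?_
  have hK0 : Tendsto (fun k : ℕ => ENNReal.ofReal (K' * (1 / 2) ^ k)) atTop (𝓝 0) := by
    have h1 := (tendsto_pow_atTop_nhds_zero_of_lt_one (r := (1 / 2 : ℝ)) (by norm_num)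
        (by norm_num)).const_mul K'
    simpa [Function.comp_def] using (ENNReal.continuous_ofReal.tendsto _).comp h1
  refine tendsto_of_tendsto_of_tendsto_of_le_of_le tendsto_const_nhds hK0
    (fun _ => zero_le) fun k => ?_
  have hv : volume (closedBall x (r / 2 ^ (k + 1) / 16)) ≠ 0 :=
    (measure_closedBall_pos volume _ (by positivity)).ne'
  refine (ENNReal.le_ofReal_iff_toReal_le (ENNReal.div_lt_top (measure_lt_top _ _).ne hv).ne
    (by positivity)).2 ?_
  rw [ENNReal.toReal_div]
  exact hν k

end Density

lemma measure_eq_zero_of_rnDeriv_eq_zero {α : Type*} [MeasurableSpace α] {ν μ : Measure α}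
    [ν.HaveLebesgueDecomposition μ] {A : Set α} (hA : MeasurableSet A)
    (h0 : ∀ x ∈ A, ν.rnDeriv μ x = 0) (hpos : ∀ E ⊆ A, MeasurableSet E → 0 < μ E → 0 < ν E) :
    μ A = 0 := by
  by_contra hne
  have hs := Measure.mutuallySingular_singularPart ν μ
  have hμ : μ (A ∩ hs.nullSet) = μ A :=
    measure_inter_conull hs.measure_compl_nullSet
  have hm : MeasurableSet (A ∩ hs.nullSet) := hA.inter hs.measurableSet_nullSet
  refine (hpos _ inter_subset_left hm (hμ ▸ pos_iff_ne_zero.2 hne)).ne' ?_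
  have hν : ν (A ∩ hs.nullSet) = (ν.singularPart μ + μ.withDensity (ν.rnDeriv μ))
      (A ∩ hs.nullSet) :=
    congrArg (fun m : Measure α => m (A ∩ hs.nullSet)) (Measure.haveLebesgueDecomposition_add ν μ)
  rw [hν, Measure.add_apply, withDensity_apply _ hm,
    measure_mono_null inter_subset_right hs.measure_nullSet,
    setLIntegral_congr_fun hm fun x hx => h0 x hx.1]
  simp

/-- **Level sets of strictly subharmonic functions are Lebesgue-null**
(Lemma 6.5, after Frank–Lieb).  Let `U ⊆ ℝ^d` be open and `ψ ∈ L¹_loc(U)`.  Suppose there is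
a nonnegative, locally finite Borel measure `μψ` on `U` such that the distributional Laplacian
of `ψ` equals `μψ`, i.e. `∫_U ψ Δϕ dx = ∫_U ϕ dμψ` for all `ϕ ∈ C_c^∞(U)`, and such that
`μψ(E) > 0` for every measurable `E ⊆ U` of positive Lebesgue measure.  Then for every
`r ∈ ℝ` the level set `{x ∈ U : ψ(x) = r}` is Lebesgue-null. -/
theorem level_set_null_of_strictly_subharmonic {d : ℕ}
    (U : Set (EuclideanSpace ℝ (Fin d))) (hUopen : IsOpen U)
    (ψ : EuclideanSpace ℝ (Fin d) → ℝ) (hψloc : LocallyIntegrableOn ψ U)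
    (μψ : Measure (EuclideanSpace ℝ (Fin d)))
    (hfin : ∀ K : Set (EuclideanSpace ℝ (Fin d)), IsCompact K → K ⊆ U → μψ K < ⊤)
    (hlap : ∀ ϕ : EuclideanSpace ℝ (Fin d) → ℝ, ContDiff ℝ (⊤ : ℕ∞) ϕ → HasCompactSupport ϕ →
      tsupport ϕ ⊆ U → ∫ x in U, ψ x * laplacian ϕ x = ∫ x in U, ϕ x ∂μψ)
    (hpos : ∀ E : Set (EuclideanSpace ℝ (Fin d)), MeasurableSet E → E ⊆ U →
      0 < volume E → 0 < μψ E) :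
    ∀ r : ℝ, volume {x ∈ U | ψ x = r} = 0 := by
  intro r
  refine measure_null_of_locally_null _ fun x hx => ?_
  obtain ⟨R, hR, hRU⟩ := nhds_basis_closedBall.mem_iff.1 (hUopen.mem_nhds hx.1)
  have hBU : ball x R ⊆ U := ball_subset_closedBall.trans hRU
  refine ⟨{x ∈ U | ψ x = r} ∩ ball x R,
    inter_mem_nhdsWithin _ (ball_mem_nhds x hR), ?_⟩
  have hψB : IntegrableOn ψ (ball x R) :=
    (hψloc.integrableOn_compact_subset hRU (isCompact_closedBall x R)).mono_set
      ball_subset_closedBall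
  have hf₀ : Integrable ((ball x R).indicator fun z => ψ z - r) :=
    (integrable_indicator_iff measurableSet_ball).2
      (hψB.sub (integrableOn_const measure_ball_lt_top.ne))
  obtain ⟨f, hfm, hff₀⟩ := hf₀.aemeasurable
  have hf : Integrable f := hf₀.congr hff₀
  have : IsFiniteMeasure (μψ.restrict (ball x R)) := ⟨by
    rw [Measure.restrict_apply_univ]
    exact (measure_mono ball_subset_closedBall).trans_lt
      (hfin _ (isCompact_closedBall x R) hRU)⟩
  have h : HasDistribLaplacianOn f (μψ.restrict (ball x R)) (ball x R) := by
    intro ϕ hϕ hc hsupp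
    have hlapi : Integrable (laplacian ϕ) :=
      (continuous_laplacian hϕ).integrable_of_hasCompactSupport
        (HasCompactSupport.of_support_subset_isCompact hc (support_laplacian_subset ϕ))
    have hlap0 : ∀ z ∉ ball x R, laplacian ϕ z = 0 := fun z hz => by
      by_contra h'
      exact hz (hsupp (support_laplacian_subset ϕ h'))
    obtain ⟨C, hC⟩ := (continuous_laplacian hϕ).bounded_above_of_compact_support
      (HasCompactSupport.of_support_subset_isCompact hc (support_laplacian_subset ϕ))
    have h1 : ∫ z, f z * laplacian ϕ z = ∫ z in ball x R, (ψ z - r) * laplacian ϕ z := by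
      rw [← integral_indicator measurableSet_ball]
      refine integral_congr_ae ?_
      filter_upwards [hff₀] with z hz
      rw [← hz]
      by_cases hzB : z ∈ ball x R <;> simp [hzB]
    have h2 : ∫ z in ball x R, (ψ z - r) * laplacian ϕ z =
        (∫ z in ball x R, ψ z * laplacian ϕ z) - ∫ z in ball x R, r * laplacian ϕ z := by
      simp only [sub_mul]
      exact integral_sub (hψB.mul_bdd (continuous_laplacian hϕ).aestronglyMeasurable
        (ae_of_all _ hC)) (hlapi.integrableOn.const_mul r)
    have h3 : ∫ z in ball x R, r * laplacian ϕ z = 0 := by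
      rw [setIntegral_eq_integral_of_forall_compl_eq_zero fun z hz => by rw [hlap0 z hz, mul_zero],
        integral_const_mul, integral_laplacian_eq_zero hϕ hc, mul_zero]
    have h4 : ∫ z in ball x R, ψ z * laplacian ϕ z = ∫ z in U, ψ z * laplacian ϕ z :=
      (setIntegral_eq_of_subset_of_forall_sdiff_eq_zero hUopen.measurableSet hBU fun z hz => by
        rw [hlap0 z hz.2, mul_zero]).symm
    rw [h1, h2, h3, h4, sub_zero, hlap ϕ hϕ hc (hsupp.trans hBU)]
    exact setIntegral_eq_of_subset_of_forall_sdiff_eq_zero hUopen.measurableSet hBU fun z hz =>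
      image_eq_zero_of_notMem_tsupport fun h' => hz.2 (hsupp h')
  set A := ball x R ∩ {z | f z = 0} ∩ {z | (μψ.restrict (ball x R)).rnDeriv volume z = 0}
  have hA : MeasurableSet A :=
    (measurableSet_ball.inter (hfm (measurableSet_singleton 0))).inter
      (Measure.measurable_rnDeriv _ _ (measurableSet_singleton 0))
  have hA0 : volume A = 0 := by
    refine measure_eq_zero_of_rnDeriv_eq_zero (ν := μψ.restrict (ball x R)) hA
      (fun z hz => hz.2) fun E hE hEm hE0 => ?_
    have hEB : E ⊆ ball x R := fun z hz => (hE hz).1.1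
    rw [Measure.restrict_eq_self _ hEB]
    exact hpos E hEm (hEB.trans hBU) hE0
  refine measure_mono_null_ae ?_ hA0
  filter_upwards [hff₀, ae_rnDeriv_eq_zero isOpen_ball hfm hf h] with z hz hz' hzr
  have hfz : f z = 0 := by
    rw [← hz, indicator_of_mem hzr.2, hzr.1.2, sub_self]
  exact ⟨⟨hzr.2, hfz⟩, hz' hzr.2 hfz⟩
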